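/- arXiv:1701.07130 — 2 statements merged into one kernel-verified Lean document; each statement's English description precedes it below -/
import Mathlib

section
/- Let 𝔅 be the random generating set of the ER-type model and let 𝔅_d = {x^α ∈ 𝔅 : deg x^α ≤ d}. (a) Let d and D be fixed with 1 ≤ d ≤ D and let p : ℕ → (0,1) (as a function of n). If n^d · p(n) → 0 as n → ∞, then P(𝔅_d = ∅) → 1; and if n^d · p(n) → ∞ as n → ∞, then P(𝔅_d = ∅) → 0. (b) Let n be fixed, let d : ℕ → ℕ satisfy d(D) ≤ D and d(D) → ∞ as D → ∞, and let p : ℕ → (0,1) (as a function of D). If d(D)^n · p(D) → 0 as D → ∞, then P(𝔅_{d(D)} = ∅) → 1; and if d(D)^n · p(D) → ∞ as D → ∞, then P(𝔅_{d(D)} = ∅) → 0. -/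
open Finset MvPolynomial Filter

noncomputable section

/-- The set of exponent vectors of nonconstant monomials in `n` variables of total degree
at most `D`. -/
def monSet (n D : ℕ) : Finset (Fin n → ℕ) :=
  (Fintype.piFinset fun _ : Fin n => Finset.range (D + 1)).filter
    fun α => 0 < ∑ i, α i ∧ ∑ i, α i ≤ D

/-- The monomial `x^α` of `MvPolynomial (Fin n) K` with exponent vector `α`. -/
def mono (K : Type*) [CommRing K] {n : ℕ} (α : Fin n → ℕ) : MvPolynomial (Fin n) K :=
  MvPolynomial.monomial (Finsupp.equivFunOnFinite.symm α) 1

/-- The monomial ideal generated by a set of exponent vectors. -/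
def idealOf (K : Type*) [CommRing K] {n : ℕ} (B : Finset (Fin n → ℕ)) :
    Ideal (MvPolynomial (Fin n) K) :=
  Ideal.span (mono K '' (B : Set (Fin n → ℕ)))

open Classical in
/-- The probability, under the ER-type model `ℐ(n,D,p)`, of the event `E` on random
generating sets `𝔅 ⊆ M(n,D)`. -/
def ERprob (n D : ℕ) (p : ℝ) (E : Set (Finset (Fin n → ℕ))) : ℝ :=
  ∑ B ∈ (monSet n D).powerset.filter (· ∈ E),
    p ^ B.card * (1 - p) ^ ((monSet n D).card - B.card)

/-- `I` is a monomial ideal. -/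
def IsMonomialIdeal (K : Type*) [CommRing K] {n : ℕ}
    (I : Ideal (MvPolynomial (Fin n) K)) : Prop :=
  ∃ G : Set (Fin n → ℕ), I = Ideal.span (mono K '' G)

/-- `x^α` is a minimal monomial generator of `I`: it lies in `I` and no proper divisor does. -/
def IsMinGen (K : Type*) [CommRing K] {n : ℕ} (I : Ideal (MvPolynomial (Fin n) K))
    (α : Fin n → ℕ) : Prop :=
  mono K α ∈ I ∧ ∀ β : Fin n → ℕ, (∀ i, β i ≤ α i) → β ≠ α → mono K β ∉ I

/-- `β₁(S/I)`: the number of minimal monomial generators of `I`. -/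
def beta1 (K : Type*) [CommRing K] {n : ℕ} (I : Ideal (MvPolynomial (Fin n) K)) : ℕ :=
  {α : Fin n → ℕ | IsMinGen K I α}.ncard

/-- `β_{1,d}(S/I)`: the number of minimal monomial generators of `I` of degree `d`. -/
def beta1d (K : Type*) [CommRing K] {n : ℕ} (I : Ideal (MvPolynomial (Fin n) K)) (d : ℕ) : ℕ :=
  {α : Fin n → ℕ | IsMinGen K I α ∧ ∑ i, α i = d}.ncard

/-- `h_I(d)`: the number of monomials of degree exactly `d` not contained in `I`. -/
def hilb (K : Type*) [CommRing K] {n : ℕ} (I : Ideal (MvPolynomial (Fin n) K)) (d : ℕ) : ℕ :=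
  {α : Fin n → ℕ | ∑ i, α i = d ∧ mono K α ∉ I}.ncard

lemma mem_monSet {n D : ℕ} {α : Fin n → ℕ} :
    α ∈ monSet n D ↔ 0 < ∑ i, α i ∧ ∑ i, α i ≤ D := by
  simp only [monSet, Finset.mem_filter, Fintype.mem_piFinset, Finset.mem_range,
    and_iff_right_iff_imp]
  rintro ⟨-, h⟩ i
  exact Nat.lt_succ_of_le ((Finset.single_le_sum (fun j _ => Nat.zero_le (α j))
    (Finset.mem_univ i)).trans h)

lemma card_monSet_add_one (n D : ℕ) : (monSet n D).card + 1 = (D + n).choose n := by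
  have hzero : (0 : Fin n → ℕ) ∉ monSet n D := by simp [mem_monSet]
  have hunion : insert 0 (monSet n D) =
      (Finset.range (D + 1)).biUnion fun k => Finset.piAntidiag Finset.univ k := by
    ext α
    have hα : α = 0 ↔ ∑ i, α i = 0 := by simp [funext_iff]
    simp only [Finset.mem_insert, mem_monSet, hα, Finset.mem_biUnion, Finset.mem_range,
      Finset.mem_piAntidiag, Finset.mem_univ, implies_true, and_true]
    constructor
    · intro h
      exact ⟨∑ i, α i, by omega, rfl⟩
    · rintro ⟨k, hk, h⟩
      replace h : ∑ i, α i = k := h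
      omega
  have hcard (k : ℕ) :
      (Finset.piAntidiag (Finset.univ : Finset (Fin n)) k).card = n.multichoose k := by
    simpa [Finset.finsuppAntidiag] using
      Finset.card_finsuppAntidiag_nat_eq_multichoose (s := (Finset.univ : Finset (Fin n))) k
  rw [← Finset.card_insert_of_notMem hzero, hunion, Finset.card_biUnion]
  · simp_rw [hcard, Nat.sum_range_multichoose]
  · intro j _ k _ hjk
    refine Finset.disjoint_left.2 fun α hj hk => hjk ?_
    rw [← (Finset.mem_piAntidiag.1 hj).1, (Finset.mem_piAntidiag.1 hk).1]

/-- The probability that no monomial of degree at most `d` is chosen. -/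
lemma ERprob_forall_not_le {n d D : ℕ} (hd : d ≤ D) (p : ℝ) :
    ERprob n D p {B : Finset (Fin n → ℕ) | ∀ α ∈ B, ¬ (∑ i, α i ≤ d)} =
      (1 - p) ^ (monSet n d).card := by
  classical
  have hsub : monSet n d ⊆ monSet n D := fun α hα => by
    rw [mem_monSet] at hα ⊢
    exact ⟨hα.1, hα.2.trans hd⟩
  have hevent : (monSet n D).powerset.filter
      (· ∈ {B : Finset (Fin n → ℕ) | ∀ α ∈ B, ¬ (∑ i, α i ≤ d)}) =
        (monSet n D \ monSet n d).powerset := by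
    ext B
    simp only [Finset.mem_filter, Finset.mem_powerset, Set.mem_ofPred_eq, Finset.subset_iff,
      Finset.mem_sdiff, mem_monSet]
    grind
  have hcard := Finset.card_sdiff_add_card_eq_card hsub
  have hterm : ∀ B ∈ (monSet n D \ monSet n d).powerset,
      p ^ B.card * (1 - p) ^ ((monSet n D).card - B.card) =
        p ^ B.card * (1 - p) ^ ((monSet n D \ monSet n d).card - B.card) *
          (1 - p) ^ (monSet n d).card := fun B hB => by
    have hB' := Finset.card_le_card (Finset.mem_powerset.1 hB)
    rw [mul_assoc, ← pow_add]
    congr 2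
    omega
  calc _ = ∑ B ∈ (monSet n D \ monSet n d).powerset,
        p ^ B.card * (1 - p) ^ ((monSet n D).card - B.card) := by
          rw [← hevent, ERprob]
          congr!
    _ = _ := by
      rw [Finset.sum_congr rfl hterm, ← Finset.sum_mul, Finset.sum_pow_mul_eq_add_pow]
      simp

lemma le_two_mul_pow_of_add_one_eq_choose {N a b : ℕ} (ha : 1 ≤ a)
    (hN : N + 1 = (a + b).choose b) : (N : ℝ) ≤ 2 ^ b * (a : ℝ) ^ b := by
  have h := Nat.choose_add_le_add_one_pow a b
  have h' : (a + 1) ^ b ≤ (2 * a) ^ b := Nat.pow_le_pow_left (by omega) b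
  rw [← mul_pow]
  exact_mod_cast (by omega : N ≤ (2 * a) ^ b)

lemma pow_le_mul_of_add_one_eq_choose {N a b : ℕ} (ha : 1 ≤ a) (hb : 1 ≤ b)
    (hN : N + 1 = (a + b).choose b) : (a : ℝ) ^ b ≤ 2 * b.factorial * N := by
  have hpow : a ^ b ≤ b.factorial * (N + 1) := by
    rw [hN, ← Nat.descFactorial_eq_factorial_mul_choose]
    refine le_trans (Nat.pow_le_pow_left ?_ b) (Nat.pow_sub_le_descFactorial _ _)
    omega
  have hpos : 1 ≤ N := by
    have h : (1 + b).choose b ≤ (a + b).choose b := Nat.choose_le_choose b (by omega)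
    rw [add_comm 1 b, Nat.choose_succ_self_right] at h
    omega
  have : a ^ b ≤ 2 * b.factorial * N := by nlinarith [b.factorial_pos]
  exact_mod_cast this

/-- If `N + 1 = (a + b).choose b` with `b` fixed and `a → ∞`, the threshold for
`(1 - p) ^ N` is `p = a ^ (-b)`. -/
lemma tendsto_one_sub_pow_threshold {b : ℕ} (hb : 1 ≤ b) {N a : ℕ → ℕ} {p : ℕ → ℝ}
    (hN : ∀ m, N m + 1 = (a m + b).choose b) (ha : Tendsto a atTop atTop)
    (hp : ∀ m, 0 < p m ∧ p m < 1) :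
    (Tendsto (fun m => (a m : ℝ) ^ b * p m) atTop (nhds 0) →
      Tendsto (fun m => (1 - p m) ^ N m) atTop (nhds 1)) ∧
    (Tendsto (fun m => (a m : ℝ) ^ b * p m) atTop atTop →
      Tendsto (fun m => (1 - p m) ^ N m) atTop (nhds 0)) := by
  have ha1 : ∀ᶠ m in atTop, 1 ≤ a m := ha.eventually_ge_atTop 1
  have hnonneg (m : ℕ) : 0 ≤ 1 - p m := sub_nonneg.2 (hp m).2.le
  constructor
  · intro h
    have hlow : Tendsto (fun m => 1 - 2 ^ b * ((a m : ℝ) ^ b * p m)) atTop (nhds 1) := by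
      simpa using (h.const_mul ((2 : ℝ) ^ b)).const_sub 1
    refine tendsto_of_tendsto_of_tendsto_of_le_of_le' hlow tendsto_const_nhds ?_
      (Eventually.of_forall fun m => pow_le_one₀ (hnonneg m) (by linarith [(hp m).1]))
    filter_upwards [ha1] with m hm
    have hbern := one_add_mul_le_pow (a := -p m) (by linarith [(hp m).2]) (N m)
    have hmul := mul_le_mul_of_nonneg_right
      (le_two_mul_pow_of_add_one_eq_choose hm (hN m)) (hp m).1.le
    rw [← sub_eq_add_neg] at hbern
    linarith
  · intro h
    have hfac : (0 : ℝ) < 2 * b.factorial := by positivity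
    have hup : Tendsto (fun m => Real.exp (-((a m : ℝ) ^ b * p m / (2 * b.factorial))))
        atTop (nhds 0) :=
      Real.tendsto_exp_neg_atTop_nhds_zero.comp (h.atTop_div_const hfac)
    refine tendsto_of_tendsto_of_tendsto_of_le_of_le' tendsto_const_nhds hup
      (Eventually.of_forall fun m => pow_nonneg (hnonneg m) _) ?_
    filter_upwards [ha1] with m hm
    refine (pow_le_pow_left₀ (hnonneg m) (Real.one_sub_le_exp_neg (p m)) (N m)).trans ?_
    rw [← Real.exp_nat_mul, Real.exp_le_exp, mul_neg, neg_le_neg_iff, div_le_iff₀ hfac]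
    have hmul := mul_le_mul_of_nonneg_right
      (pow_le_mul_of_add_one_eq_choose hm hb (hN m)) (hp m).1.le
    linarith

/-- Lemma 4.3. Thresholds for `𝔅_d = ∅`, where
`𝔅_d = {x^α ∈ 𝔅 : deg x^α ≤ d}`.
(a) For fixed `1 ≤ d ≤ D` and `p` a function of `n`: if `n^d p(n) → 0` then
`P(𝔅_d = ∅) → 1`, and if `n^d p(n) → ∞` then `P(𝔅_d = ∅) → 0`.
(b) For fixed `n`, `d = d(D) ≤ D` with `d(D) → ∞`, and `p` a function of `D`: if
`d(D)^n p(D) → 0` then `P(𝔅_{d(D)} = ∅) → 1`, and if `d(D)^n p(D) → ∞` then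
`P(𝔅_{d(D)} = ∅) → 0`. -/
theorem stmt13 :
    (∀ (d D : ℕ), 1 ≤ d → d ≤ D → ∀ p : ℕ → ℝ, (∀ n, 0 < p n ∧ p n < 1) →
      (Filter.Tendsto (fun n : ℕ => (n : ℝ) ^ d * p n) Filter.atTop (nhds 0) →
        Filter.Tendsto (fun n : ℕ => ERprob n D (p n)
            {B : Finset (Fin n → ℕ) | ∀ α ∈ B, ¬ (∑ i, α i ≤ d)})
          Filter.atTop (nhds 1)) ∧
      (Filter.Tendsto (fun n : ℕ => (n : ℝ) ^ d * p n) Filter.atTop Filter.atTop →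
        Filter.Tendsto (fun n : ℕ => ERprob n D (p n)
            {B : Finset (Fin n → ℕ) | ∀ α ∈ B, ¬ (∑ i, α i ≤ d)})
          Filter.atTop (nhds 0))) ∧
    (∀ (n : ℕ), 1 ≤ n → ∀ d : ℕ → ℕ, (∀ D, d D ≤ D) →
      Filter.Tendsto d Filter.atTop Filter.atTop →
      ∀ p : ℕ → ℝ, (∀ D, 0 < p D ∧ p D < 1) →
      (Filter.Tendsto (fun D : ℕ => (d D : ℝ) ^ n * p D) Filter.atTop (nhds 0) →
        Filter.Tendsto (fun D : ℕ => ERprob n D (p D)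
            {B : Finset (Fin n → ℕ) | ∀ α ∈ B, ¬ (∑ i, α i ≤ d D)})
          Filter.atTop (nhds 1)) ∧
      (Filter.Tendsto (fun D : ℕ => (d D : ℝ) ^ n * p D) Filter.atTop Filter.atTop →
        Filter.Tendsto (fun D : ℕ => ERprob n D (p D)
            {B : Finset (Fin n → ℕ) | ∀ α ∈ B, ¬ (∑ i, α i ≤ d D)})
          Filter.atTop (nhds 0))) := by
  refine ⟨fun d D hd hdD p hp => ?_, fun n hn d hdD hd p hp => ?_⟩
  · simp_rw [ERprob_forall_not_le hdD]
    refine tendsto_one_sub_pow_threshold hd (fun n => ?_) tendsto_id hp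
    rw [card_monSet_add_one, add_comm d n, Nat.choose_symm_add]
  · simp_rw [fun D => ERprob_forall_not_le (n := n) (hdD D) (p D)]
    exact tendsto_one_sub_pow_threshold hn (fun D => card_monSet_add_one n (d D)) hd hp
end
end

section
/- Let n be fixed, let p : ℕ → (0,1) be a function of D, and let r : ℕ → ℕ satisfy r(D) → ∞ as D → ∞ and r(D) · p(D) → ∞ as D → ∞. Let 𝔍 = 𝔍(D) be the random monomial ideal of the ER-type model with parameter p(D). Then the probability that every minimal generator of 𝔍 has degree at most n · r(D) tends to 1 as D → ∞; that is, the degree complexity dc(𝔍) ≤ n·r(D) asymptotically almost surely. -/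
open Finset MvPolynomial Filter

noncomputable section

/-- Weight of the generating set `B` in the ER-type model is nonnegative. -/
theorem weight_nonneg {p : ℝ} (h0 : 0 ≤ p) (h1 : p ≤ 1) (a b : ℕ) :
    0 ≤ p ^ a * (1 - p) ^ b :=
  mul_nonneg (pow_nonneg h0 _) (pow_nonneg (sub_nonneg.2 h1) _)

theorem ERprob_le_one (n D : ℕ) {p : ℝ} (h0 : 0 ≤ p) (h1 : p ≤ 1)
    (E : Set (Finset (Fin n → ℕ))) : ERprob n D p E ≤ 1 := by
  classical
  have h := Finset.sum_pow_mul_eq_add_pow p (1 - p) (monSet n D)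
  rw [add_sub_cancel, one_pow] at h
  rw [← h, ERprob]
  exact Finset.sum_le_sum_of_subset_of_nonneg (Finset.filter_subset _ _)
    fun _ _ _ => weight_nonneg h0 h1 _ _

/-- The probability that `𝔅` avoids a given set `T` of monomials is `(1 - p) ^ #T`. -/
theorem ERprob_disjoint (n D : ℕ) (p : ℝ) {T : Finset (Fin n → ℕ)} (hT : T ⊆ monSet n D) :
    ERprob n D p {B | Disjoint B T} = (1 - p) ^ T.card := by
  classical
  have hfilter : (monSet n D).powerset.filter (· ∈ {B | Disjoint B T}) =
      (monSet n D \ T).powerset := by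
    ext B
    simp [Finset.subset_sdiff]
  have hcard := Finset.card_sdiff_add_card_eq_card hT
  have h := Finset.sum_pow_mul_eq_add_pow p (1 - p) (monSet n D \ T)
  rw [add_sub_cancel, one_pow] at h
  have key : ERprob n D p {B | Disjoint B T} =
      ∑ B ∈ (monSet n D \ T).powerset, p ^ B.card * (1 - p) ^ ((monSet n D).card - B.card) := by
    rw [← hfilter, ERprob]
    congr!
  refine key.trans (Eq.trans ?_ (one_mul ((1 - p) ^ T.card)))
  nth_rewrite 2 [← h]
  rw [Finset.sum_mul]
  refine Finset.sum_congr rfl fun B hB => ?_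
  have hB' := Finset.card_le_card (Finset.mem_powerset.1 hB)
  rw [mul_assoc, ← pow_add]
  congr 2
  omega

/-- Union bound: if outside `E` one of the events `F i` occurs, then
`1 ≤ P(E) + ∑ i, P(F i)`. -/
theorem one_le_ERprob_add_sum {ι : Type*} [Fintype ι] (n D : ℕ) {p : ℝ} (h0 : 0 ≤ p)
    (h1 : p ≤ 1) (E : Set (Finset (Fin n → ℕ))) (F : ι → Set (Finset (Fin n → ℕ)))
    (hEF : ∀ B ⊆ monSet n D, B ∉ E → ∃ i, B ∈ F i) :
    1 ≤ ERprob n D p E + ∑ i, ERprob n D p (F i) := by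
  classical
  have h := Finset.sum_pow_mul_eq_add_pow p (1 - p) (monSet n D)
  rw [add_sub_cancel, one_pow] at h
  rw [← h]
  simp only [ERprob, Finset.sum_filter]
  rw [Finset.sum_comm, ← Finset.sum_add_distrib]
  refine Finset.sum_le_sum fun B hB => ?_
  have hw := weight_nonneg h0 h1 B.card ((monSet n D).card - B.card)
  have hnn : ∀ i ∈ Finset.univ, 0 ≤ (if B ∈ F i then
      p ^ B.card * (1 - p) ^ ((monSet n D).card - B.card) else 0) := fun i _ => by
    split_ifs <;> simp [hw]
  by_cases hE : B ∈ E
  · rw [if_pos hE]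
    exact le_add_of_nonneg_right (Finset.sum_nonneg hnn)
  · obtain ⟨i, hi⟩ := hEF B (Finset.mem_powerset.1 hB) hE
    rw [if_neg hE, zero_add]
    refine le_trans ?_ (Finset.single_le_sum hnn (Finset.mem_univ i))
    rw [if_pos hi]

/-- Exponent vectors of the pure powers `x_i, x_i ^ 2, …, x_i ^ r`. -/
def purePowers {n : ℕ} (i : Fin n) (r : ℕ) : Finset (Fin n → ℕ) :=
  (Finset.Icc 1 r).image (Pi.single i)

theorem card_purePowers {n : ℕ} (i : Fin n) (r : ℕ) : (purePowers i r).card = r := by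
  rw [purePowers, Finset.card_image_of_injective _ (Pi.single_injective i), Nat.card_Icc,
    Nat.add_sub_cancel]

theorem purePowers_subset_monSet {n D r : ℕ} (i : Fin n) (hr : r ≤ D) :
    purePowers i r ⊆ monSet n D := by
  intro α hα
  obtain ⟨j, hj, rfl⟩ := Finset.mem_image.1 hα
  rw [Finset.mem_Icc] at hj
  simp only [monSet, Finset.mem_filter, Fintype.mem_piFinset, Finset.mem_range,
    Finset.sum_pi_single', Finset.mem_univ, if_true]
  refine ⟨fun k => ?_, ?_⟩
  · rcases eq_or_ne k i with rfl | hk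
    · rw [Pi.single_eq_same]; omega
    · rw [Pi.single_eq_of_ne hk]; omega
  · omega

theorem mono_mem_idealOf {K : Type*} [CommRing K] {n : ℕ} {B : Finset (Fin n → ℕ)}
    {α : Fin n → ℕ} (h : α ∈ B) : mono K α ∈ idealOf K B :=
  Ideal.subset_span (Set.mem_image_of_mem _ h)

/-- Every minimal generator of the ideal generated by `B` lies in `B`. -/
theorem IsMinGen.mem {K : Type*} [CommRing K] [Nontrivial K] {n : ℕ}
    {B : Finset (Fin n → ℕ)} {α : Fin n → ℕ} (h : IsMinGen K (idealOf K B) α) : α ∈ B := by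
  have hspan : idealOf K B = Ideal.span ((fun s => MvPolynomial.monomial s (1 : K)) ''
      (Finsupp.equivFunOnFinite.symm '' (B : Set (Fin n → ℕ)))) := by
    rw [Set.image_image]; rfl
  have hmem := h.1
  rw [hspan, MvPolynomial.mem_ideal_span_monomial_image] at hmem
  obtain ⟨_, ⟨β, hβ, rfl⟩, hle⟩ := hmem (Finsupp.equivFunOnFinite.symm α) (by
    classical simp [mono, MvPolynomial.support_monomial])
  by_contra hα
  exact h.2 β (fun i => hle i) (fun he => hα (he ▸ hβ)) (mono_mem_idealOf hβ)

/-- If `B` contains one of `x_i, …, x_i ^ r`, then the `x_i`-exponent of a minimal generator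
is at most `r`. -/
theorem IsMinGen.apply_le {K : Type*} [CommRing K] {n r : ℕ} {B : Finset (Fin n → ℕ)}
    {α : Fin n → ℕ} (h : IsMinGen K (idealOf K B) α) {i : Fin n}
    (hi : ¬ Disjoint B (purePowers i r)) : α i ≤ r := by
  obtain ⟨_, hB, hp⟩ := Finset.not_disjoint_iff.1 hi
  obtain ⟨j, hj, rfl⟩ := Finset.mem_image.1 hp
  rw [Finset.mem_Icc] at hj
  by_contra! hlt
  refine h.2 (Pi.single i j) (fun k => ?_) (fun he => ?_) (mono_mem_idealOf hB)
  · rcases eq_or_ne k i with rfl | hk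
    · rw [Pi.single_eq_same]; omega
    · rw [Pi.single_eq_of_ne hk]; omega
  · have := congrFun he i
    rw [Pi.single_eq_same] at this
    omega

/-- Lower bound for the probability that all minimal generators have degree at most `n * r`. -/
theorem one_sub_exp_le_ERprob (K : Type*) [Field K] {n : ℕ} (hn : 1 ≤ n) (D r : ℕ) {p : ℝ}
    (h0 : 0 ≤ p) (h1 : p ≤ 1) :
    1 - n * Real.exp (-(r * p)) ≤ ERprob n D p {B : Finset (Fin n → ℕ) |
      ∀ α : Fin n → ℕ, IsMinGen K (idealOf K B) α → ∑ i, α i ≤ n * r} := by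
  rcases le_or_gt r D with hr | hr
  · have h := one_le_ERprob_add_sum n D h0 h1 {B : Finset (Fin n → ℕ) |
        ∀ α : Fin n → ℕ, IsMinGen K (idealOf K B) α → ∑ i, α i ≤ n * r}
      (fun i => {B | Disjoint B (purePowers i r)}) (fun B _ hE => by
        by_contra! hF
        refine hE fun α hα => ?_
        calc ∑ i, α i ≤ ∑ _i : Fin n, r := Finset.sum_le_sum fun i _ => hα.apply_le (hF i)
          _ = n * r := by simp)
    simp only [ERprob_disjoint n D p (purePowers_subset_monSet _ hr), card_purePowers,
      Finset.sum_const, Finset.card_univ, Fintype.card_fin, nsmul_eq_mul] at h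
    have hexp : (1 - p) ^ r ≤ Real.exp (-(r * p)) := by
      rw [← mul_neg, Real.exp_nat_mul]
      exact pow_le_pow_left₀ (sub_nonneg.2 h1) (Real.one_sub_le_exp_neg p) r
    have := mul_le_mul_of_nonneg_left hexp n.cast_nonneg
    linarith
  · have h := one_le_ERprob_add_sum n D h0 h1 {B : Finset (Fin n → ℕ) |
        ∀ α : Fin n → ℕ, IsMinGen K (idealOf K B) α → ∑ i, α i ≤ n * r}
      (fun i : Empty => i.elim) (fun B hB hE => (hE fun α hα => by
        have := (Finset.mem_filter.1 (hB hα.mem)).2.2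
        nlinarith).elim)
    rw [Fintype.sum_empty, add_zero] at h
    have : 0 ≤ n * Real.exp (-(r * p)) := by positivity
    linarith

/-- Theorem 4.7. For fixed `n`, if `r(D) → ∞` and `p(D) = ω(1/r(D))`,
then a.a.s. every minimal generator of `𝔍` has degree at most `n·r(D)`, i.e.,
`dc(𝔍) ≤ n·r(D)` asymptotically almost surely as `D → ∞`. -/
theorem stmt17 (K : Type*) [Field K] (n : ℕ) (hn : 1 ≤ n)
    (p : ℕ → ℝ) (hp : ∀ D, 0 < p D ∧ p D < 1)
    (r : ℕ → ℕ) (hr : Filter.Tendsto r Filter.atTop Filter.atTop)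
    (hrp : Filter.Tendsto (fun D : ℕ => (r D : ℝ) * p D) Filter.atTop Filter.atTop) :
    Filter.Tendsto (fun D : ℕ => ERprob n D (p D)
        {B : Finset (Fin n → ℕ) |
          ∀ α : Fin n → ℕ, IsMinGen K (idealOf K B) α → ∑ i, α i ≤ n * r D})
      Filter.atTop (nhds 1) := by
  have hexp : Tendsto (fun D => 1 - n * Real.exp (-((r D : ℝ) * p D))) atTop (nhds 1) := by
    simpa using ((Real.tendsto_exp_neg_atTop_nhds_zero.comp hrp).const_mul (n : ℝ)).const_sub 1
  exact tendsto_of_tendsto_of_tendsto_of_le_of_le hexp tendsto_const_nhds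
    (fun D => one_sub_exp_le_ERprob K hn D (r D) (hp D).1.le (hp D).2.le)
    (fun D => ERprob_le_one n D (hp D).1.le (hp D).2.le _)

end
end
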